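/- Let k be an algebraically closed field, A a spectroid over k, and M an indecomposable module in mod A which is not projective in mod A. Then there exists an almost split sequence 0 → L → E → M → 0 in mod A if and only if M is finitely presented. -/

import Mathlib

open CategoryTheory CategoryTheory.Limits

namespace Paper

variable (k : Type) [Field k]

section General

variable (A : Type) [Category.{0} A] [Preadditive A] [CategoryTheory.Linear k A]

/-- A spectroid over `k`: a (small) Hom-finite `k`-linear category in which every object
has a local endomorphism ring and distinct objects are not isomorphic. -/
class Spectroid : Prop where
  homFinite : ∀ a b : A, FiniteDimensional k (a ⟶ b)
  localEnd : ∀ a : A, IsLocalRing (End a)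
  skeletal : ∀ a b : A, (a ≅ b) → a = b

variable {A}

/-- `M` is a module over `A`, i.e. the functor `M : A ⥤ ModuleCat k` is additive and
`k`-linear on morphisms. -/
def IsMod (M : A ⥤ ModuleCat.{0} k) : Prop :=
  (∀ {a b : A} (f g : a ⟶ b), M.map (f + g) = M.map f + M.map g) ∧
  (∀ {a b : A} (r : k) (f : a ⟶ b), M.map (r • f) = r • M.map f)

/-- `M` is a locally finite dimensional module over `A`, i.e. an object of `mod A`. -/
def IsLfdMod (M : A ⥤ ModuleCat.{0} k) : Prop :=
  IsMod k M ∧ ∀ a : A, FiniteDimensional k (M.obj a)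

/-- The projective module `P_a = Hom_A(a, -)` at an object `a`. -/
noncomputable def ProjAt (a : A) : A ⥤ ModuleCat.{0} k :=
  (linearCoyoneda k A).obj (Opposite.op a)

/-- The injective module `I_a = D Hom_A(-, a)` at an object `a`. -/
noncomputable def InjAt (a : A) : A ⥤ ModuleCat.{0} k where
  obj b := ModuleCat.of k (Module.Dual k (b ⟶ a))
  map {b c} f := ModuleCat.ofHom (LinearMap.dualMap (Linear.leftComp k a f))
  map_id b := by
    have h : Linear.leftComp k a (𝟙 b) = LinearMap.id := by
      apply LinearMap.ext; intro g; simp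
    rw [h, LinearMap.dualMap_id]; rfl
  map_comp {b c d} f g := by
    have h : Linear.leftComp k a (f ≫ g) =
        (Linear.leftComp k a f).comp (Linear.leftComp k a g) := by
      apply LinearMap.ext; intro h; simp
    rw [h]; rfl

instance : HasFiniteBiproducts (A ⥤ ModuleCat.{0} k) :=
  CategoryTheory.Abelian.hasFiniteBiproducts

/-- `M` is finitely generated: there is an epimorphism `⊕_{i=1}^r P_{a_i} → M`. -/
def IsFG (M : A ⥤ ModuleCat.{0} k) : Prop :=
  ∃ (r : ℕ) (a : Fin r → A) (f : (⨁ fun i => ProjAt k (a i)) ⟶ M), Epi f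

/-- `M` is finitely presented: there is an epimorphism `⊕_{i=1}^r P_{a_i} → M` with
finitely generated kernel. -/
def IsFP (M : A ⥤ ModuleCat.{0} k) : Prop :=
  ∃ (r : ℕ) (a : Fin r → A) (f : (⨁ fun i => ProjAt k (a i)) ⟶ M),
    Epi f ∧ IsFG k (kernel f)

/-- `M` is finitely co-generated: there is a monomorphism `M → ⊕_{j=1}^s I_{b_j}`. -/
def IsFCG (M : A ⥤ ModuleCat.{0} k) : Prop :=
  ∃ (s : ℕ) (b : Fin s → A) (f : M ⟶ ⨁ fun j => InjAt k (b j)), Mono f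

/-- `M` is finitely co-presented: there is a monomorphism `M → ⊕_{j=1}^s I_{b_j}` with
finitely co-generated cokernel. -/
def IsFCP (M : A ⥤ ModuleCat.{0} k) : Prop :=
  ∃ (s : ℕ) (b : Fin s → A) (f : M ⟶ ⨁ fun j => InjAt k (b j)),
    Mono f ∧ IsFCG k (cokernel f)

/-- `f` is an irreducible morphism in `mod A`: it is neither a split mono nor a split epi,
and in any factorization `f = g ≫ h` through an object of `mod A`, `g` is a split mono
or `h` is a split epi. -/
def Irred {L M : A ⥤ ModuleCat.{0} k} (f : L ⟶ M) : Prop :=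
  ¬ IsSplitMono f ∧ ¬ IsSplitEpi f ∧
    ∀ ⦃X : A ⥤ ModuleCat.{0} k⦄, IsLfdMod k X →
      ∀ (g : L ⟶ X) (h : X ⟶ M), g ≫ h = f → IsSplitMono g ∨ IsSplitEpi h

/-- `M` is an indecomposable object of `mod A`: it is nonzero, and whenever `M ≅ X ⊞ Y`
with `X`, `Y` in `mod A`, one of `X`, `Y` is zero. -/
def Indec (M : A ⥤ ModuleCat.{0} k) : Prop :=
  ¬ IsZero M ∧ ∀ ⦃X Y : A ⥤ ModuleCat.{0} k⦄, IsLfdMod k X → IsLfdMod k Y →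
    (M ≅ X ⊞ Y) → IsZero X ∨ IsZero Y

/-- `0 → L →f M →g N → 0` is an almost split sequence in `mod A`. -/
structure AlmostSplitSeq {L M N : A ⥤ ModuleCat.{0} k} (f : L ⟶ M) (g : M ⟶ N) : Prop where
  mono : Mono f
  epi : Epi g
  zero : f ≫ g = 0
  exact : (ShortComplex.mk f g zero).Exact
  not_splitMono : ¬ IsSplitMono f
  not_splitEpi : ¬ IsSplitEpi g
  left_almost_split : ∀ ⦃X : A ⥤ ModuleCat.{0} k⦄, IsLfdMod k X →
    ∀ u : L ⟶ X, ¬ IsSplitMono u → ∃ v : M ⟶ X, f ≫ v = u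
  right_almost_split : ∀ ⦃X : A ⥤ ModuleCat.{0} k⦄, IsLfdMod k X →
    ∀ u : X ⟶ N, ¬ IsSplitEpi u → ∃ v : X ⟶ M, v ≫ g = u

/-- `M` is projective as an object of `mod A`. -/
def ProjInMod (M : A ⥤ ModuleCat.{0} k) : Prop :=
  ∀ ⦃X Y : A ⥤ ModuleCat.{0} k⦄, IsLfdMod k X → IsLfdMod k Y →
    ∀ (e : X ⟶ Y), Epi e → ∀ u : M ⟶ Y, ∃ t : M ⟶ X, t ≫ e = u

/-- `M` is injective as an object of `mod A`. -/
def InjInMod (M : A ⥤ ModuleCat.{0} k) : Prop :=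
  ∀ ⦃X Y : A ⥤ ModuleCat.{0} k⦄, IsLfdMod k X → IsLfdMod k Y →
    ∀ (m : X ⟶ Y), Mono m → ∀ u : X ⟶ M, ∃ t : Y ⟶ M, m ≫ t = u

/-- `h` is a (nonempty) composition of irreducible morphisms between indecomposable
objects of `mod A`. -/
inductive IrredChain : ∀ {X Y : A ⥤ ModuleCat.{0} k}, (X ⟶ Y) → Prop
  | single {X Y : A ⥤ ModuleCat.{0} k} (f : X ⟶ Y) :
      IsLfdMod k X → Indec k X → IsLfdMod k Y → Indec k Y → Irred k f → IrredChain f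
  | comp {X Y Z : A ⥤ ModuleCat.{0} k} (f : X ⟶ Y) (g : Y ⟶ Z) :
      IsLfdMod k X → Indec k X → Irred k f → IrredChain g → IrredChain (f ≫ g)

end General

section QuiverSection

variable (Q : Type) [Quiver.{0} Q]

/-- `Q` is locally finite: every vertex is the source of finitely many arrows and the
target of finitely many arrows. -/
def LocallyFinite : Prop :=
  ∀ x : Q, Finite (Σ y : Q, x ⟶ y) ∧ Finite (Σ y : Q, y ⟶ x)

/-- `Q` is interval finite: there are finitely many paths between any two vertices. -/
def IntervalFinite : Prop :=
  ∀ x y : Q, Finite (Quiver.Path x y)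

/-- `Q` is strongly locally finite: locally finite and interval finite. -/
def StronglyLocallyFinite : Prop :=
  LocallyFinite Q ∧ IntervalFinite Q

/-- `Q` is connected: nonempty, and any two vertices are joined by a walk. -/
def QuiverConnected : Prop :=
  Nonempty Q ∧ ∀ x y : Q,
    Nonempty (Quiver.Path (Quiver.Symmetrify.of.obj x) (Quiver.Symmetrify.of.obj y))

/-- The path category `kQ` of the quiver `Q`: the free `k`-linear category on the free
category on `Q`. -/
abbrev PathCat := CategoryTheory.Free k (Paths Q)

/-- A vertex of `Q`, seen as an object of the path category `kQ`. -/
noncomputable def vtx (x : Q) : PathCat k Q :=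
  (Free.embedding k (Paths Q)).obj ((Paths.of Q).obj x)

/-- An arrow of `Q`, seen as a morphism of the path category `kQ`. -/
noncomputable def arrHom {x y : Q} (α : x ⟶ y) : vtx k Q x ⟶ vtx k Q y :=
  (Free.embedding k (Paths Q)).map ((Paths.of Q).map α)

/-- The degree of a vertex of `Q`: the total number of arrows incident to it. -/
noncomputable def degree (x : Q) : ℕ :=
  Nat.card ((Σ y : Q, x ⟶ y) ⊕ (Σ y : Q, y ⟶ x))

/-- `M` belongs to `rrep(Q)`: it is the middle term of a short exact sequence
`0 → L → M → N → 0` with `L` finitely presented, `N` finitely co-presented, and only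
finitely many arrows `α` of `Q` satisfy `M(α) ≠ 0`, `L(α) = 0` and `N(α) = 0`. -/
def InRrep (M : PathCat k Q ⥤ ModuleCat.{0} k) : Prop :=
  ∃ (L N : PathCat k Q ⥤ ModuleCat.{0} k) (f : L ⟶ M) (g : M ⟶ N) (zero : f ≫ g = 0),
    Mono f ∧ Epi g ∧ (ShortComplex.mk f g zero).Exact ∧ IsFP k L ∧ IsFCP k N ∧
    Set.Finite {p : Σ (x : Q) (y : Q), x ⟶ y |
      M.map (arrHom k Q p.2.2) ≠ 0 ∧ L.map (arrHom k Q p.2.2) = 0 ∧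
      N.map (arrHom k Q p.2.2) = 0}

variable {Q}

/-- The vertices occurring in a path. -/
def InPath {x : Q} : ∀ {y : Q}, Quiver.Path x y → Q → Prop
  | _, Quiver.Path.nil, v => v = x
  | _, @Quiver.Path.cons _ _ _ _ c p _, v => v = c ∨ InPath p v

variable (Q)

/-- `Q` is a star quiver: it is obtained from a finite full convex subquiver `Γ` by
attaching finitely many rays and co-rays with no common vertices. -/
def IsStarQuiver : Prop :=
  ∃ (Γ S₁ S₂ : Set Q) (v : Q → ℕ → Q),
    Γ.Finite ∧ S₁ ⊆ Γ ∧ S₂ ⊆ Γ ∧ Disjoint S₁ S₂ ∧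
    (∀ x y : Q, x ∈ Γ → y ∈ Γ → ∀ p : Quiver.Path x y, ∀ z : Q, InPath p z → z ∈ Γ) ∧
    (∀ s ∈ S₁ ∪ S₂, ∀ i : ℕ, v s i ∉ Γ) ∧
    (∀ s ∈ S₁ ∪ S₂, ∀ t ∈ S₁ ∪ S₂, ∀ i j : ℕ, v s i = v t j → s = t ∧ i = j) ∧
    (∀ x : Q, x ∉ Γ → ∃ s ∈ S₁ ∪ S₂, ∃ i : ℕ, x = v s i) ∧
    (∀ s ∈ S₁, Nat.card (s ⟶ v s 0) = 1 ∧ ∀ i : ℕ, Nat.card (v s i ⟶ v s (i + 1)) = 1) ∧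
    (∀ s ∈ S₂, Nat.card (v s 0 ⟶ s) = 1 ∧ ∀ i : ℕ, Nat.card (v s (i + 1) ⟶ v s i) = 1) ∧
    (∀ x y : Q, (x ⟶ y) → ¬(x ∈ Γ ∧ y ∈ Γ) →
      (∃ s ∈ S₁, (x = s ∧ y = v s 0) ∨ ∃ i : ℕ, x = v s i ∧ y = v s (i + 1)) ∨
      (∃ s ∈ S₂, (x = v s 0 ∧ y = s) ∨ ∃ i : ℕ, x = v s (i + 1) ∧ y = v s i))

end QuiverSection

section AlmostSplit

variable {k} {A : Type} [Category.{0} A]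

section Elements

/-- The action of a morphism of `A` on a module. -/
def act (M : A ⥤ ModuleCat.{0} k) {a b : A} (f : a ⟶ b) : M.obj a →ₗ[k] M.obj b :=
  (M.map f).hom

/-- The component of a morphism of modules at an object, as a linear map. -/
def ap {M N : A ⥤ ModuleCat.{0} k} (u : M ⟶ N) (c : A) : M.obj c →ₗ[k] N.obj c :=
  (u.app c).hom

variable {M N X : A ⥤ ModuleCat.{0} k}

@[simp] lemma act_id (a : A) (x : M.obj a) : act M (𝟙 a) x = x := by simp [act]

@[simp] lemma act_comp {a b c : A} (f : a ⟶ b) (g : b ⟶ c) (x : M.obj a) :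
    act M (f ≫ g) x = act M g (act M f x) := by simp [act]

@[simp] lemma ap_id (c : A) (x : M.obj c) : ap (𝟙 M) c x = x := by simp [ap]

@[simp] lemma ap_comp (u : M ⟶ N) (v : N ⟶ X) (c : A) (x : M.obj c) :
    ap (u ≫ v) c x = ap v c (ap u c x) := by simp [ap]

@[simp] lemma ap_zero (c : A) (x : M.obj c) : ap (0 : M ⟶ N) c x = 0 := by simp [ap]

@[simp] lemma ap_add (u v : M ⟶ N) (c : A) (x : M.obj c) :
    ap (u + v) c x = ap u c x + ap v c x := by simp [ap]

lemma ap_sum {ι : Type} (s : Finset ι) (u : ι → (M ⟶ N)) (c : A) (x : M.obj c) :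
    ap (∑ i ∈ s, u i) c x = ∑ i ∈ s, ap (u i) c x := by
  classical
  induction s using Finset.induction_on with
  | empty => simp
  | insert i s hi ih => rw [Finset.sum_insert hi, Finset.sum_insert hi, ap_add, ih]

@[simp] lemma ap_smul (t : k) (u : M ⟶ N) (c : A) (x : M.obj c) :
    ap (t • u) c x = t • ap u c x := by simp [ap]

lemma ap_act (u : M ⟶ N) {a b : A} (f : a ⟶ b) (x : M.obj a) :
    ap u b (act M f x) = act N f (ap u a x) := by
  have := u.naturality f
  exact LinearMap.congr_fun (congrArg ModuleCat.Hom.hom this) x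

lemma hom_ext_ap {u v : M ⟶ N} (h : ∀ c x, ap u c x = ap v c x) : u = v := by
  ext c x
  exact h c x

/-- A morphism of modules from a natural family of linear maps. -/
def mkHom (φ : ∀ c, M.obj c →ₗ[k] N.obj c)
    (h : ∀ {a b : A} (f : a ⟶ b) x, φ b (act M f x) = act N f (φ a x)) : M ⟶ N where
  app c := ModuleCat.ofHom (φ c)
  naturality a b f := by
    ext x
    exact h f x

@[simp] lemma ap_mkHom (φ : ∀ c, M.obj c →ₗ[k] N.obj c) (h) (c : A) (x : M.obj c) :
    ap (mkHom φ h) c x = φ c x := rfl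

lemma mono_iff_ap {u : M ⟶ N} : Mono u ↔ ∀ c, Function.Injective (ap u c) := by
  rw [NatTrans.mono_iff_mono_app]
  exact forall_congr' fun c => ModuleCat.mono_iff_injective _

lemma epi_iff_ap {u : M ⟶ N} : Epi u ↔ ∀ c, Function.Surjective (ap u c) := by
  rw [NatTrans.epi_iff_epi_app]
  exact forall_congr' fun c => ModuleCat.epi_iff_surjective _

lemma isIso_of_bijective_ap {u : M ⟶ N} (h : ∀ c, Function.Bijective (ap u c)) : IsIso u := by
  have := mono_iff_ap.2 fun c => (h c).1
  have := epi_iff_ap.2 fun c => (h c).2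
  exact isIso_of_mono_of_epi u

lemma eq_zero_of_isZero (h : IsZero M) {c : A} (x : M.obj c) : x = 0 := by
  rw [← ap_id (M := M) c x, h.eq_zero_of_src (𝟙 M), ap_zero]

lemma act_ap_pow (p : M ⟶ M) (n : ℕ) {a b : A} (f : a ⟶ b) (x : M.obj a) :
    act M f ((ap p a ^ n) x) = (ap p b ^ n) (act M f x) := by
  induction n generalizing x with
  | zero => simp
  | succ n ih => rw [pow_succ, pow_succ, Module.End.mul_apply, Module.End.mul_apply, ih, ap_act]

lemma exists_pushout_eq (f : M ⟶ N) (u : M ⟶ X) {c : A} (y : (pushout f u).obj c) :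
    ∃ e x, ap (pushout.inl f u) c e + ap (pushout.inr f u) c x = y := by
  have : Epi (biprod.desc (pushout.inl f u) (pushout.inr f u)) := ⟨fun v w h => by
    apply pushout.hom_ext
    · simpa using congrArg (biprod.inl ≫ ·) h
    · simpa using congrArg (biprod.inr ≫ ·) h⟩
  obtain ⟨z, rfl⟩ := epi_iff_ap.1 this c y
  refine ⟨ap biprod.fst c z, ap biprod.snd c z, ?_⟩
  rw [← ap_comp, ← ap_comp, ← ap_add, ← biprod.desc_eq]

/-- The submodule functor cut out by a stable family of subspaces. -/
def subFun (M : A ⥤ ModuleCat.{0} k) (W : ∀ c, Submodule k (M.obj c))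
    (hW : ∀ {a b : A} (f : a ⟶ b), ∀ x ∈ W a, act M f x ∈ W b) : A ⥤ ModuleCat.{0} k where
  obj c := ModuleCat.of k (W c)
  map f := ModuleCat.ofHom ((act M f).restrict (hW f))
  map_id a := ModuleCat.hom_ext (LinearMap.ext fun _ => Subtype.ext (act_id a _))
  map_comp f g := ModuleCat.hom_ext (LinearMap.ext fun _ => Subtype.ext (act_comp f g _))

section Sub

variable {W : ∀ c, Submodule k (M.obj c)}
  (hW : ∀ {a b : A} (f : a ⟶ b), ∀ x ∈ W a, act M f x ∈ W b)

/-- The inclusion of a submodule functor. -/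
def subIncl : subFun M W hW ⟶ M :=
  mkHom (fun c => (W c).subtype) fun _ _ => rfl

lemma subIncl_injective (c : A) : Function.Injective (ap (subIncl hW) c) :=
  Subtype.val_injective

lemma ap_subIncl_mem (c : A) (x) : ap (subIncl hW) c x ∈ W c := x.2

/-- Corestriction of a morphism to a submodule functor. -/
def subLift (u : X ⟶ M) (hu : ∀ c x, ap u c x ∈ W c) : X ⟶ subFun M W hW :=
  mkHom (fun c => (ap u c).codRestrict (W c) (hu c)) fun f x => Subtype.ext (ap_act u f x)

/-- The quotient functor by a stable family of subspaces. -/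
def quotFun : A ⥤ ModuleCat.{0} k where
  obj c := ModuleCat.of k (M.obj c ⧸ W c)
  map {a b} f := ModuleCat.ofHom ((W a).mapQ (W b) (act M f) (hW f))
  map_id a := ModuleCat.hom_ext <| LinearMap.ext fun x => by
    obtain ⟨x, rfl⟩ := (W a).mkQ_surjective x
    exact congrArg (W a).mkQ (act_id a x)
  map_comp {a b c} f g := ModuleCat.hom_ext <| LinearMap.ext fun x => by
    obtain ⟨x, rfl⟩ := (W a).mkQ_surjective x
    exact congrArg (W c).mkQ (act_comp f g x)

/-- The projection onto a quotient functor. -/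
def quotProj : M ⟶ quotFun hW :=
  mkHom (fun c => (W c).mkQ) fun _ _ => rfl

lemma quotProj_surjective (c : A) : Function.Surjective (ap (quotProj hW) c) :=
  (W c).mkQ_surjective

lemma ap_quotProj_eq_zero {c : A} {x : M.obj c} : ap (quotProj hW) c x = 0 ↔ x ∈ W c :=
  Submodule.Quotient.mk_eq_zero _

end Sub

/-- Lift of a morphism along a pointwise injective one. -/
lemma exists_lift_of_injective {i : M ⟶ N} (hi : ∀ c, Function.Injective (ap i c)) (u : X ⟶ N)
    (hu : ∀ c x, ∃ y, ap i c y = ap u c x) : ∃ v : X ⟶ M, v ≫ i = u := by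
  choose φ hφ using hu
  refine ⟨mkHom (fun c => ⟨⟨φ c, fun x y => hi c ?_⟩, fun t x => hi c ?_⟩) fun f x => hi _ ?_, ?_⟩
  · simp [hφ]
  · simp [hφ]
  · simp [hφ, ap_act]
  · exact hom_ext_ap fun c x => by simp [hφ]

lemma exists_ap_kernel_ι_eq (u : M ⟶ N) {c : A} {x : M.obj c} (hx : ap u c x = 0) :
    ∃ y, ap (kernel.ι u) c y = x := by
  have hW : ∀ {a b : A} (f : a ⟶ b), ∀ x ∈ LinearMap.ker (ap u a),
      act M f x ∈ LinearMap.ker (ap u b) := by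
    intro a b f x hx
    rw [LinearMap.mem_ker] at hx ⊢
    rw [ap_act, hx, map_zero]
  have h0 : subIncl hW ≫ u = 0 := hom_ext_ap fun c x => by
    rw [ap_comp, ap_zero]
    exact ap_subIncl_mem hW c x
  let z : (subFun M _ hW).obj c := (⟨x, hx⟩ : LinearMap.ker (ap u c))
  refine ⟨ap (kernel.lift u (subIncl hW) h0) c z, ?_⟩
  rw [← ap_comp, kernel.lift_ι]
  rfl

lemma ap_kernel_ι_injective (u : M ⟶ N) (c : A) : Function.Injective (ap (kernel.ι u) c) :=
  mono_iff_ap.1 inferInstance c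

/-- The product of two modules. -/
def prodFun (M N : A ⥤ ModuleCat.{0} k) : A ⥤ ModuleCat.{0} k where
  obj c := ModuleCat.of k (M.obj c × N.obj c)
  map f := ModuleCat.ofHom ((act M f).prodMap (act N f))
  map_id a := ModuleCat.hom_ext (LinearMap.ext fun _ => Prod.ext (act_id a _) (act_id a _))
  map_comp f g :=
    ModuleCat.hom_ext (LinearMap.ext fun _ => Prod.ext (act_comp f g _) (act_comp f g _))

/-- The product of a family of modules. -/
def piFun {ι : Type} (M : ι → A ⥤ ModuleCat.{0} k) : A ⥤ ModuleCat.{0} k where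
  obj c := ModuleCat.of k (∀ i, (M i).obj c)
  map f := ModuleCat.ofHom (LinearMap.pi fun i => act (M i) f ∘ₗ LinearMap.proj i)
  map_id a := ModuleCat.hom_ext (LinearMap.ext fun _ => funext fun _ => act_id a _)
  map_comp f g := ModuleCat.hom_ext (LinearMap.ext fun _ => funext fun _ => act_comp f g _)

end Elements

section Modules

variable [Preadditive A] [CategoryTheory.Linear k A] {M N X : A ⥤ ModuleCat.{0} k}

lemma act_add (hM : IsMod k M) {a b : A} (f g : a ⟶ b) (x : M.obj a) :
    act M (f + g) x = act M f x + act M g x := by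
  simp [act, hM.1]

lemma act_smul (hM : IsMod k M) {a b : A} (t : k) (f : a ⟶ b) (x : M.obj a) :
    act M (t • f) x = t • act M f x := by
  simp [act, hM.2]

lemma isMod_of_act (h₁ : ∀ {a b : A} (f g : a ⟶ b) x, act M (f + g) x = act M f x + act M g x)
    (h₂ : ∀ {a b : A} (t : k) (f : a ⟶ b) x, act M (t • f) x = t • act M f x) : IsMod k M :=
  ⟨fun f g => ModuleCat.hom_ext (LinearMap.ext (h₁ f g)),
    fun t f => ModuleCat.hom_ext (LinearMap.ext (h₂ t f))⟩

lemma isMod_of_injective (u : M ⟶ N) (hu : ∀ c, Function.Injective (ap u c)) (hN : IsMod k N) :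
    IsMod k M :=
  isMod_of_act (fun f g x => hu _ (by simp [ap_act, act_add hN]))
    (fun t f x => hu _ (by simp [ap_act, act_smul hN]))

lemma isMod_of_surjective (u : M ⟶ N) (hu : ∀ c, Function.Surjective (ap u c))
    (hM : IsMod k M) : IsMod k N :=
  isMod_of_act
    (fun {a _} f g x => by obtain ⟨x, rfl⟩ := hu a x; simp [← ap_act, act_add hM])
    (fun {a _} t f x => by obtain ⟨x, rfl⟩ := hu a x; simp [← ap_act, act_smul hM])

lemma isLfdMod_of_injective (u : M ⟶ N) (hu : ∀ c, Function.Injective (ap u c))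
    (hN : IsLfdMod k N) : IsLfdMod k M :=
  ⟨isMod_of_injective u hu hN.1, fun c =>
    have := hN.2 c
    FiniteDimensional.of_injective (ap u c) (hu c)⟩

lemma isLfdMod_of_surjective (u : M ⟶ N) (hu : ∀ c, Function.Surjective (ap u c))
    (hM : IsLfdMod k M) : IsLfdMod k N :=
  ⟨isMod_of_surjective u hu hM.1, fun c =>
    have := hM.2 c
    Module.Finite.of_surjective (ap u c) (hu c)⟩

lemma isLfdMod_prodFun (hM : IsLfdMod k M) (hN : IsLfdMod k N) : IsLfdMod k (prodFun M N) :=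
  ⟨isMod_of_act (fun f g x => Prod.ext (act_add hM.1 f g x.1) (act_add hN.1 f g x.2))
    (fun t f x => Prod.ext (act_smul hM.1 t f x.1) (act_smul hN.1 t f x.2)), fun c =>
    have := hM.2 c
    have := hN.2 c
    inferInstanceAs (FiniteDimensional k (M.obj c × N.obj c))⟩

lemma isMod_piFun {ι : Type} {M : ι → A ⥤ ModuleCat.{0} k} (hM : ∀ i, IsMod k (M i)) :
    IsMod k (piFun M) :=
  isMod_of_act (fun f g x => funext fun i => act_add (hM i) f g (x i))
    (fun t f x => funext fun i => act_smul (hM i) t f (x i))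

lemma isLfdMod_piFun {ι : Type} [Finite ι] {M : ι → A ⥤ ModuleCat.{0} k}
    (hM : ∀ i, IsLfdMod k (M i)) : IsLfdMod k (piFun M) :=
  ⟨isMod_piFun fun i => (hM i).1, fun c =>
    have := fun i => (hM i).2 c
    inferInstanceAs (FiniteDimensional k (∀ i, (M i).obj c))⟩

/-- Elements of `P_a` are morphisms out of `a`. -/
def projEquiv (a b : A) : (a ⟶ b) ≃ₗ[k] (ProjAt k a).obj b := LinearEquiv.refl k (a ⟶ b)

lemma act_projEquiv (a : A) {b c : A} (f : b ⟶ c) (h : a ⟶ b) :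
    act (ProjAt k a) f (projEquiv a b h) = projEquiv a c (h ≫ f) := rfl

lemma isMod_projAt (a : A) : IsMod k (ProjAt k a) :=
  isMod_of_act (fun f g (x : a ⟶ _) => Preadditive.comp_add _ _ _ x f g)
    (fun t f (x : a ⟶ _) => Linear.comp_smul _ _ _ x t f)

lemma isLfdMod_projAt [Spectroid k A] (a : A) : IsLfdMod k (ProjAt k a) :=
  ⟨isMod_projAt a, fun b =>
    have := Spectroid.homFinite (k := k) a b
    Module.Finite.equiv (projEquiv a b)⟩

/-- Elements of `I_a` are functionals on morphisms into `a`. -/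
def injEquiv (a b : A) : Module.Dual k (b ⟶ a) ≃ₗ[k] (InjAt k a).obj b :=
  LinearEquiv.refl k (Module.Dual k (b ⟶ a))

lemma injEquiv_symm_act (a : A) {b c : A} (f : b ⟶ c) (θ : (InjAt k a).obj b) (h : c ⟶ a) :
    (injEquiv a c).symm (act (InjAt k a) f θ) h = (injEquiv a b).symm θ (f ≫ h) := rfl

lemma isLfdMod_injAt [Spectroid k A] (a : A) : IsLfdMod k (InjAt k a) := by
  refine ⟨isMod_of_act (fun {b c} f g θ => ?_) (fun {b c} t f θ => ?_), fun b => ?_⟩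
  · refine (injEquiv a c).symm.injective (LinearMap.ext fun h => ?_)
    simp [injEquiv_symm_act]
  · refine (injEquiv a c).symm.injective (LinearMap.ext fun h => ?_)
    simp [injEquiv_symm_act]
  · have := Spectroid.homFinite (k := k) b a
    exact Module.Finite.equiv (injEquiv a b)

section Comb

variable {ι κ : Type} [Fintype κ] {a : ι → A} {b : κ → A}

/-- The coefficients of a combination of combinations. -/
def mulCoeff (r : ∀ j i, a i ⟶ b j) (c : A) : (∀ j, b j ⟶ c) →ₗ[k] (∀ i, a i ⟶ c) where
  toFun t i := ∑ j, r j i ≫ t j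
  map_add' t t' := by ext; simp [Finset.sum_add_distrib]
  map_smul' t t' := by ext; simp [Finset.smul_sum]

lemma mulCoeff_apply (r : ∀ j i, a i ⟶ b j) {c : A} (t : ∀ j, b j ⟶ c) (i : ι) :
    mulCoeff (k := k) r c t i = ∑ j, r j i ≫ t j := rfl

lemma mulCoeff_comp (r : ∀ j i, a i ⟶ b j) {c d : A} (t : ∀ j, b j ⟶ c) (f : c ⟶ d) :
    mulCoeff (k := k) r d (fun j => t j ≫ f) = fun i => mulCoeff (k := k) r c t i ≫ f := by
  ext; simp [mulCoeff_apply, Preadditive.sum_comp]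

variable [Fintype ι]

/-- The linear combination of the elements `m i` with coefficients in `A`. -/
def comb (hM : IsMod k M) (m : ∀ i, M.obj (a i)) (c : A) :
    (∀ i, a i ⟶ c) →ₗ[k] M.obj c where
  toFun h := ∑ i, act M (h i) (m i)
  map_add' h h' := by simp [act_add hM, Finset.sum_add_distrib]
  map_smul' t h := by simp [act_smul hM, Finset.smul_sum]

lemma comb_apply (hM : IsMod k M) (m : ∀ i, M.obj (a i)) {c : A} (h : ∀ i, a i ⟶ c) :
    comb hM m c h = ∑ i, act M (h i) (m i) := rfl

lemma act_comb (hM : IsMod k M) (m : ∀ i, M.obj (a i)) {c d : A} (f : c ⟶ d)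
    (h : ∀ i, a i ⟶ c) : act M f (comb hM m c h) = comb hM m d fun i => h i ≫ f := by
  simp [comb_apply]

lemma ap_comb (hM : IsMod k M) (hN : IsMod k N) (u : M ⟶ N) (m : ∀ i, M.obj (a i)) {c : A}
    (h : ∀ i, a i ⟶ c) : ap u c (comb hM m c h) = comb hN (fun i => ap u (a i) (m i)) c h := by
  simp [comb_apply, ap_act]

lemma comb_single [DecidableEq ι] (hM : IsMod k M) (m : ∀ i, M.obj (a i)) {c : A} (i : ι)
    (h : a i ⟶ c) : comb hM m c (Pi.single i h) = act M h (m i) := by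
  rw [comb_apply, Finset.sum_eq_single i]
  · simp
  · intro j _ hj
    rw [Pi.single_eq_of_ne hj, ← zero_smul k (0 : a j ⟶ c), act_smul hM, zero_smul]
  · simp

lemma comb_mulCoeff (hM : IsMod k M) (m : ∀ i, M.obj (a i)) (r : ∀ j i, a i ⟶ b j) {c : A}
    (t : ∀ j, b j ⟶ c) :
    comb hM m c (mulCoeff (k := k) r c t) = comb hM (fun j => comb hM m (b j) (r j)) c t := by
  have : mulCoeff (k := k) r c t = ∑ j, fun i => r j i ≫ t j := by
    ext i; simp [mulCoeff_apply]
  rw [this, map_sum, comb_apply]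
  simp [act_comb]

/-- The elements `m i` generate `M`. -/
def Generates (hM : IsMod k M) (m : ∀ i, M.obj (a i)) : Prop :=
  ∀ c, Function.Surjective (comb hM m c)

/-- The elements `m i` and the relations `r j` form a presentation of `M`. -/
structure IsPres (hM : IsMod k M) (m : ∀ i, M.obj (a i)) (r : ∀ j i, a i ⟶ b j) : Prop where
  gen : Generates hM m
  rel : ∀ j, comb hM m (b j) (r j) = 0
  complete : ∀ c (h : ∀ i, a i ⟶ c), comb hM m c h = 0 → ∃ t, mulCoeff (k := k) r c t = h

lemma Generates.hom_ext {hM : IsMod k M} {m : ∀ i, M.obj (a i)} (hm : Generates hM m)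
    (hX : IsMod k X) {u v : M ⟶ X} (h : ∀ i, ap u (a i) (m i) = ap v (a i) (m i)) : u = v := by
  refine hom_ext_ap fun c x => ?_
  obtain ⟨x, rfl⟩ := hm c x
  simp only [ap_comb hM hX, h]

lemma IsPres.exists_desc {hM : IsMod k M} {m : ∀ i, M.obj (a i)} {r : ∀ j i, a i ⟶ b j}
    (h : IsPres hM m r) (hX : IsMod k X) (y : ∀ i, X.obj (a i))
    (hy : ∀ j, comb hX y (b j) (r j) = 0) : ∃ v : M ⟶ X, ∀ i, ap v (a i) (m i) = y i := by
  classical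
  have key : ∀ c (s : ∀ i, a i ⟶ c), comb hM m c s = 0 → comb hX y c s = 0 := by
    intro c s hs
    obtain ⟨t, rfl⟩ := h.complete c s hs
    rw [comb_mulCoeff]
    simp [hy, comb_apply]
  have key' : ∀ c (s s' : ∀ i, a i ⟶ c), comb hM m c s = comb hM m c s' →
      comb hX y c s = comb hX y c s' := by
    intro c s s' hs
    rw [← sub_eq_zero, ← map_sub] at hs ⊢
    exact key c _ hs
  choose φ hφ using h.gen
  have hv : ∀ c (s : ∀ i, a i ⟶ c), comb hX y c (φ c (comb hM m c s)) = comb hX y c s :=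
    fun c s => key' c _ _ (hφ c _)
  refine ⟨mkHom (fun c => ⟨⟨fun x => comb hX y c (φ c x), fun x x' => ?_⟩, fun t x => ?_⟩)
    fun {c d} f x => ?_, fun i => ?_⟩
  · rw [← map_add]; exact key' c _ _ (by simp [hφ])
  · rw [← map_smul]; exact key' c _ _ (by simp [hφ])
  · change comb hX y d (φ d _) = act X f (comb hX y c (φ c x))
    rw [act_comb]
    refine key' d _ _ ?_
    rw [← act_comb, hφ, hφ]
  · change comb hX y (a i) (φ (a i) (m i)) = y i
    have := hv (a i) (Pi.single i (𝟙 _))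
    simpa [comb_single] using this

lemma Generates.of_surjective {hM : IsMod k M} {m : ∀ i, M.obj (a i)} (hm : Generates hM m)
    (hN : IsMod k N) (u : M ⟶ N) (hu : ∀ c, Function.Surjective (ap u c)) :
    Generates hN fun i => ap u (a i) (m i) := by
  intro c y
  obtain ⟨x, rfl⟩ := hu c y
  obtain ⟨h, rfl⟩ := hm c x
  exact ⟨h, (ap_comb hM hN u m h).symm⟩

lemma comb_reindex {ι' : Type} [Fintype ι'] (e : ι' ≃ ι) (hM : IsMod k M)
    (m : ∀ i, M.obj (a i)) {c : A} (h : ∀ i, a i ⟶ c) :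
    comb (a := fun i => a (e i)) hM (fun i => m (e i)) c (fun i => h (e i)) = comb hM m c h :=
  e.sum_comp fun i => act M (h i) (m i)

lemma IsPres.reindex {ι' : Type} [Fintype ι'] (e : ι' ≃ ι) {hM : IsMod k M}
    {m : ∀ i, M.obj (a i)} {r : ∀ j i, a i ⟶ b j} (h : IsPres hM m r) :
    IsPres (a := fun i => a (e i)) hM (fun i => m (e i)) (fun j i => r j (e i)) where
  gen c x := by
    obtain ⟨s, rfl⟩ := h.gen c x
    exact ⟨fun i => s (e i), comb_reindex e hM m s⟩
  rel j := (comb_reindex e hM m (r j)).trans (h.rel j)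
  complete c s hs := by
    obtain ⟨s, rfl⟩ := (Equiv.piCongrLeft (fun i => a i ⟶ c) e).symm.surjective s
    obtain ⟨t, rfl⟩ := h.complete c s ((comb_reindex e hM m s).symm.trans hs)
    exact ⟨t, rfl⟩

section Biproduct

variable {n : ℕ} (a : Fin n → A)

lemma biproduct_total_apply {c : A} (z : (⨁ fun i => ProjAt k (a i)).obj c) :
    ∑ i, ap (biproduct.ι (fun i => ProjAt k (a i)) i) c
      (ap (biproduct.π (fun i => ProjAt k (a i)) i) c z) = z := by
  have h := congrArg (fun u => ap u c z) (biproduct.total (f := fun i => ProjAt k (a i)))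
  simpa only [ap_sum, ap_comp, ap_id] using h

lemma isMod_biproduct : IsMod k (⨁ fun i => ProjAt k (a i)) :=
  isMod_of_injective (N := piFun fun i => ProjAt k (a i))
    (mkHom (fun c => LinearMap.pi fun i => ap (biproduct.π (fun i => ProjAt k (a i)) i) c)
      fun f x => funext fun i => ap_act (biproduct.π (fun i => ProjAt k (a i)) i) f x)
    (fun c x y hxy => by
      rw [← biproduct_total_apply a x, ← biproduct_total_apply a y]
      exact Finset.sum_congr rfl fun i _ => congrArg _ (congrFun hxy i))
    (isMod_piFun fun i => isMod_projAt (a i))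

/-- The canonical generators of `⊕ P_{a_i}`. -/
noncomputable def unitElt (i : Fin n) : (⨁ fun i => ProjAt k (a i)).obj (a i) :=
  ap (biproduct.ι (fun i => ProjAt k (a i)) i) (a i) (projEquiv (a i) (a i) (𝟙 (a i)))

lemma act_unitElt {c : A} (i : Fin n) (h : a i ⟶ c) :
    act _ h (unitElt (k := k) a i) = ap (biproduct.ι (fun i => ProjAt k (a i)) i) c
      (projEquiv (a i) c h) := by
  rw [unitElt, ← ap_act, act_projEquiv, Category.id_comp]

lemma isPres_biproduct :
    IsPres (isMod_biproduct (k := k) a) (unitElt a) (b := Empty.elim) (fun j => j.elim) where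
  gen c z := by
    refine ⟨fun i => (projEquiv (a i) c).symm
      (ap (biproduct.π (fun i => ProjAt k (a i)) i) c z), ?_⟩
    simp only [comb_apply, act_unitElt, LinearEquiv.apply_symm_apply]
    exact biproduct_total_apply a z
  rel j := j.elim
  complete c h hh := by
    refine ⟨fun j => j.elim, funext fun i => ?_⟩
    have := congrArg (ap (biproduct.π (fun i => ProjAt k (a i)) i) c) hh
    rw [comb_apply, map_sum, map_zero, Finset.sum_eq_single i] at this
    · rw [act_unitElt, ← ap_comp, biproduct.ι_π_self, ap_id] at this
      rw [mulCoeff_apply]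
      exact ((LinearEquiv.map_eq_zero_iff _).1 this).symm
    · intro j _ hj
      rw [act_unitElt, ← ap_comp, biproduct.ι_π_ne _ hj, ap_zero]
    · simp

end Biproduct

lemma IsPres.eq_of_comb_eq {hM : IsMod k M} {m : ∀ i, M.obj (a i)}
    {r : ∀ (j : Empty) i, a i ⟶ Empty.elim j} (h : IsPres hM m r) {c : A} :
    Function.Injective (comb hM m c) := by
  rw [injective_iff_map_eq_zero]
  intro s hs
  obtain ⟨t, rfl⟩ := h.complete c s hs
  ext
  simp [mulCoeff_apply]

lemma isFG_of_generates {hM : IsMod k M} {m : ∀ i, M.obj (a i)} (hm : Generates hM m) :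
    IsFG k M := by
  let e := (Fintype.equivFin ι).symm
  obtain ⟨f, hf⟩ := (isPres_biproduct (k := k) fun i => a (e i)).exists_desc hM
    (fun i => m (e i)) (fun j => j.elim)
  refine ⟨_, _, f, epi_iff_ap.2 fun c x => ?_⟩
  obtain ⟨h, rfl⟩ := hm c x
  refine ⟨comb (isMod_biproduct _) (unitElt _) c fun i => h (e i), ?_⟩
  rw [ap_comb _ hM, funext hf]
  exact comb_reindex e hM m h

lemma exists_generates_of_isFG (hM : IsMod k M) (h : IsFG k M) :
    ∃ (n : ℕ) (a : Fin n → A) (m : ∀ i, M.obj (a i)), Generates hM m := by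
  obtain ⟨n, a, f, hf⟩ := h
  exact ⟨n, a, _, (isPres_biproduct a).gen.of_surjective hM f (epi_iff_ap.1 hf)⟩

lemma IsPres.isFP {hM : IsMod k M} {m : ∀ i, M.obj (a i)} {r : ∀ j i, a i ⟶ b j}
    (h : IsPres hM m r) : IsFP k M := by
  let e := (Fintype.equivFin ι).symm
  have h := h.reindex e
  have hB := isPres_biproduct (k := k) fun i => a (e i)
  obtain ⟨f, hf⟩ := hB.exists_desc hM (fun i => m (e i)) (fun j => j.elim)
  have hfc (c) (s : ∀ i, a (e i) ⟶ c) :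
      ap f c (comb (isMod_biproduct _) (unitElt _) c s) =
        comb hM (fun i => m (e i)) c s := by
    rw [ap_comb _ hM, funext hf]
  refine ⟨_, _, f, epi_iff_ap.2 fun c x => ?_, ?_⟩
  · obtain ⟨s, rfl⟩ := h.gen c x
    exact ⟨_, hfc c s⟩
  · have hK : IsMod k (kernel f) :=
      isMod_of_injective _ (ap_kernel_ι_injective f) (isMod_biproduct _)
    choose w hw using fun j => exists_ap_kernel_ι_eq f ((hfc (b j) _).trans (h.rel j))
    refine isFG_of_generates (hM := hK) (m := w) fun c x => ?_
    obtain ⟨s, hs⟩ := hB.gen c (ap (kernel.ι f) c x)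
    have h0 : comb hM (fun i => m (e i)) c s = 0 := by
      rw [← hfc, hs, ← ap_comp, kernel.condition, ap_zero]
    obtain ⟨t, rfl⟩ := h.complete c s h0
    refine ⟨t, ap_kernel_ι_injective f c ?_⟩
    rw [ap_comb hK (isMod_biproduct _), funext hw, ← hs, comb_mulCoeff]

lemma exists_isPres_of_isFP (hM : IsMod k M) (h : IsFP k M) :
    ∃ (n p : ℕ) (a : Fin n → A) (b : Fin p → A) (m : ∀ i, M.obj (a i))
      (r : ∀ j i, a i ⟶ b j), IsPres hM m r := by
  obtain ⟨n, a, f, hf, hK⟩ := h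
  have hB := isPres_biproduct (k := k) a
  obtain ⟨p, b, w, hw⟩ := exists_generates_of_isFG
    (isMod_of_injective _ (ap_kernel_ι_injective f) (isMod_biproduct a)) hK
  choose r hr using fun j => hB.gen (b j) (ap (kernel.ι f) (b j) (w j))
  have hfc (c) (s : ∀ i, a i ⟶ c) : ap f c (comb (isMod_biproduct _) (unitElt _) c s) =
      comb hM (fun i => ap f (a i) (unitElt a i)) c s := ap_comb _ hM _ _ _
  refine ⟨n, p, a, b, _, r, hB.gen.of_surjective hM f (epi_iff_ap.1 hf), fun j => ?_,
    fun c s hs => ?_⟩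
  · rw [← hfc, hr, ← ap_comp, kernel.condition, ap_zero]
  · obtain ⟨y, hy⟩ := exists_ap_kernel_ι_eq f ((hfc c s).trans hs)
    obtain ⟨t, rfl⟩ := hw c y
    refine ⟨t, hB.eq_of_comb_eq ?_⟩
    rw [comb_mulCoeff, ← hy, ap_comb _ (isMod_biproduct a), funext hr]

end Comb

section Existence

variable {ι κ : Type} {a : ι → A} {b : κ → A}

/-- Elements of `⊕ P_{a_i}` are families of morphisms. -/
def freeEquiv (a : ι → A) (c : A) :
    (∀ i, a i ⟶ c) ≃ₗ[k] (piFun fun i => ProjAt k (a i)).obj c := LinearEquiv.refl k (∀ i, a i ⟶ c)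

lemma act_freeEquiv {c d : A} (f : c ⟶ d) (h : ∀ i, a i ⟶ c) :
    act _ f (freeEquiv (k := k) a c h) = freeEquiv a d fun i => h i ≫ f := rfl

variable [Fintype ι] [Fintype κ]

lemma comb_freeEquiv_single [DecidableEq ι] (hF : IsMod k (piFun fun i => ProjAt k (a i))) {c : A}
    (h : ∀ i, a i ⟶ c) :
    comb hF (fun i => freeEquiv a (a i) (Pi.single i (𝟙 (a i)))) c h = freeEquiv a c h := by
  simp only [comb_apply, act_freeEquiv, ← map_sum]
  congr 1
  ext i
  rw [Finset.sum_apply, Finset.sum_eq_single i]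
  · simp
  · intro j _ hj
    rw [Pi.single_eq_of_ne hj.symm, zero_comp]
  · simp

/-- Every finite system of relations is the presentation of a module. -/
lemma exists_isPres [Spectroid k A] (r : ∀ j i, a i ⟶ b j) :
    ∃ (N : A ⥤ ModuleCat.{0} k) (hN : IsLfdMod k N) (n : ∀ i, N.obj (a i)), IsPres hN.1 n r := by
  classical
  have hF : IsLfdMod k (piFun fun i => ProjAt k (a i)) :=
    isLfdMod_piFun fun i => isLfdMod_projAt (a i)
  let W : ∀ c, Submodule k ((piFun fun i => ProjAt k (a i)).obj c) := fun c =>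
    (LinearMap.range (mulCoeff r c)).map (freeEquiv a c).toLinearMap
  have hmem (c) (h : ∀ i, a i ⟶ c) : freeEquiv a c h ∈ W c ↔ ∃ t, mulCoeff (k := k) r c t = h := by
    simp [W]
  have hW : ∀ {c d : A} (f : c ⟶ d), ∀ x ∈ W c, act _ f x ∈ W d := by
    intro c d f x hx
    obtain ⟨h, rfl⟩ := (freeEquiv a c).surjective x
    rw [act_freeEquiv]
    obtain ⟨t, rfl⟩ := (hmem c h).1 hx
    exact (hmem d _).2 ⟨_, mulCoeff_comp r t f⟩
  have hN : IsLfdMod k (quotFun hW) :=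
    isLfdMod_of_surjective (quotProj hW) (quotProj_surjective hW) hF
  let n (i : ι) := ap (quotProj hW) (a i) (freeEquiv a (a i) (Pi.single i (𝟙 (a i))))
  have hn (c) (h : ∀ i, a i ⟶ c) : comb hN.1 n c h = ap (quotProj hW) c (freeEquiv a c h) := by
    rw [← ap_comb hF.1, comb_freeEquiv_single]
  refine ⟨_, hN, n, fun c x => ?_, fun j => ?_, fun c h hh => ?_⟩
  · obtain ⟨x, rfl⟩ := quotProj_surjective hW c x
    obtain ⟨h, rfl⟩ := (freeEquiv a c).surjective x
    exact ⟨h, hn c h⟩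
  · rw [hn, ap_quotProj_eq_zero, hmem]
    refine ⟨Pi.single j (𝟙 _), funext fun i => ?_⟩
    rw [mulCoeff_apply, Finset.sum_eq_single j]
    · simp
    · intro j' _ hj
      rw [Pi.single_eq_of_ne hj, comp_zero]
    · simp
  · rwa [hn, ap_quotProj_eq_zero, hmem] at hh

/-- A direct summand of a finitely presented module is finitely presented. -/
lemma IsPres.isFP_of_retract {hN : IsMod k N} {n : ∀ i, N.obj (a i)} {r : ∀ j i, a i ⟶ b j}
    (h : IsPres hN n r) (hM : IsMod k M) (i : M ⟶ N) (p : N ⟶ M) (hip : i ≫ p = 𝟙 M) :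
    IsFP k M := by
  classical
  have hp (c) (x : M.obj c) : ap p c (ap i c x) = x := by rw [← ap_comp, hip, ap_id]
  choose e he using fun l => h.gen (a l) (ap i (a l) (ap p (a l) (n l)))
  let q : ∀ (j : κ ⊕ ι) (l : ι), a l ⟶ Sum.elim b a j := fun j => match j with
    | .inl j => r j
    | .inr l => Pi.single l (𝟙 (a l)) - e l
  have hcomb (c) (s : ∀ l, a l ⟶ c) :
      ap p c (comb hN n c s) = comb hM (fun l => ap p (a l) (n l)) c s := ap_comb hN hM p n s
  refine IsPres.isFP (hM := hM) (m := fun l => ap p (a l) (n l)) (r := q)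
    ⟨h.gen.of_surjective hM p fun c x => ⟨_, hp c x⟩, fun j => ?_, fun c s hs => ?_⟩
  · match j with
    | .inl j => exact (hcomb _ _).symm.trans ((congrArg (ap p (b j)) (h.rel j)).trans (map_zero _))
    | .inr l =>
      change comb hM _ (a l) (Pi.single l (𝟙 (a l)) - e l) = 0
      rw [map_sub, comb_single, ← hcomb, he, hp, act_id, sub_self]
  · have h0 : comb hN n c (mulCoeff (k := k) e c s) = 0 := by
      rw [comb_mulCoeff, funext he]
      simp only [← ap_comp]
      rw [← ap_comb hN hN (p ≫ i), ap_comp, hcomb, hs, map_zero]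
    obtain ⟨t, ht⟩ := h.complete c _ h0
    refine ⟨fun j => match j with
      | .inl j => t j
      | .inr l => s l, funext fun l => ?_⟩
    have h1 := congrFun ht l
    rw [mulCoeff_apply, mulCoeff_apply] at h1
    rw [mulCoeff_apply, Fintype.sum_sum_type]
    change ∑ j, r j l ≫ t j +
      ∑ l', (Pi.single (M := fun l => a l ⟶ a l') l' (𝟙 (a l')) - e l') l ≫ s l' = s l
    simp only [Pi.sub_apply, Preadditive.sub_comp, Finset.sum_sub_distrib]
    rw [h1, add_sub_cancel, Finset.sum_eq_single l]
    · simp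
    · intro l' _ hl
      rw [Pi.single_eq_of_ne hl.symm, zero_comp]
    · simp

/-- If `M` is not finitely presented, finite systems of elements and relations of `M` lift along
right almost split morphisms. -/
lemma exists_lift_of_not_isFP [Spectroid k A] {E : A ⥤ ModuleCat.{0} k} (hM : IsMod k M)
    (hE : IsMod k E) {g : E ⟶ M}
    (hg : ∀ ⦃X : A ⥤ ModuleCat.{0} k⦄, IsLfdMod k X → ∀ u : X ⟶ M, ¬ IsSplitEpi u →
      ∃ v : X ⟶ E, v ≫ g = u)
    (hfp : ¬ IsFP k M) (m : ∀ i, M.obj (a i)) (r : ∀ j i, a i ⟶ b j)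
    (hr : ∀ j, comb hM m (b j) (r j) = 0) :
    ∃ e : ∀ i, E.obj (a i), (∀ i, ap g (a i) (e i) = m i) ∧ ∀ j, comb hE e (b j) (r j) = 0 := by
  obtain ⟨N, hN, n, h⟩ := exists_isPres (k := k) r
  obtain ⟨p, hp⟩ := h.exists_desc hM m hr
  obtain ⟨v, hv⟩ := hg hN p fun hs => hfp (h.isFP_of_retract hM (section_ p) p (by simp))
  refine ⟨fun i => ap v (a i) (n i), fun i => ?_, fun j => ?_⟩
  · rw [← ap_comp, hv, hp]
  · rw [← ap_comb hN.1 hE, h.rel, map_zero]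

end Existence

section Compactness

/-- A limit functional on families of scalars indexed by the finite subsets of a type. -/
lemma exists_limit_functional (T : Type) : ∃ l : (Finset T → k) →ₗ[k] k, l (fun _ => 1) = 1 ∧
    ∀ (t : T) (f f' : Finset T → k), (∀ R, t ∈ R → f R = f' R) → l f = l f' := by
  classical
  let W : Submodule k (Finset T → k) :=
    { carrier := {f | ∃ R₀, ∀ R, R₀ ⊆ R → f R = 0}
      zero_mem' := ⟨∅, fun _ _ => rfl⟩
      add_mem' := by
        rintro f f' ⟨R, hR⟩ ⟨R', hR'⟩
        refine ⟨R ∪ R', fun S hS => ?_⟩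
        simp [hR S (Finset.union_subset_left hS), hR' S (Finset.union_subset_right hS)]
      smul_mem' := by
        rintro c f ⟨R, hR⟩
        exact ⟨R, fun S hS => by simp [hR S hS]⟩ }
  have h1 : (fun _ => 1 : Finset T → k) ∉ W := by
    rintro ⟨R, hR⟩
    exact one_ne_zero (hR R subset_rfl)
  obtain ⟨l, hl, hW⟩ := Submodule.exists_le_ker_of_notMem h1
  refine ⟨(l fun _ => 1)⁻¹ • l, by simp [hl], fun t f f' h => ?_⟩
  have : l (f - f') = 0 := hW ⟨{t}, fun R hR => by simp [h R (by simpa using hR)]⟩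
  rw [map_sub, sub_eq_zero] at this
  simp [this]

lemma exists_limit {I V : Type} [AddCommGroup V] [Module k V] [FiniteDimensional k V]
    (l : (I → k) →ₗ[k] k) (f : I → V) : ∃ v : V, ∀ φ : Module.Dual k V, φ v = l fun i => φ (f i) := by
  let ψ : Module.Dual k (Module.Dual k V) := l ∘ₗ LinearMap.pi fun i => Module.Dual.eval k V (f i)
  exact ⟨(Module.evalEquiv k V).symm ψ, fun φ => by simp; rfl⟩

lemma isFP_of_rightAlmostSplit [Spectroid k A] {E : A ⥤ ModuleCat.{0} k} (hM : IsLfdMod k M)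
    (hE : IsLfdMod k E) {g : E ⟶ M} [Epi g] (hgs : ¬ IsSplitEpi g)
    (hg : ∀ ⦃X : A ⥤ ModuleCat.{0} k⦄, IsLfdMod k X → ∀ u : X ⟶ M, ¬ IsSplitEpi u →
      ∃ v : X ⟶ E, v ≫ g = u) : IsFP k M := by
  classical
  by_contra hfp
  let T := Σ (a b : A), (a ⟶ b) × k × M.obj a × M.obj b
  have hsurj := epi_iff_ap.1 (inferInstance : Epi g)
  have key : ∀ R : Finset T, ∃ s : ∀ a, M.obj a → E.obj a, (∀ a x, ap g a (s a x) = x) ∧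
      ∀ (a b : A) (f : a ⟶ b) (c : k) (x : M.obj a) (y : M.obj b), (⟨a, b, f, c, x, y⟩ : T) ∈ R →
        s b (c • act M f x + y) = c • act E f (s a x) + s b y := by
    intro R
    let S : Finset (Σ a, M.obj a) := R.biUnion fun t =>
      {⟨t.1, t.2.2.2.2.1⟩, ⟨t.2.1, t.2.2.2.2.2⟩,
        ⟨t.2.1, t.2.2.2.1 • act M t.2.2.1 t.2.2.2.2.1 + t.2.2.2.2.2⟩}
    have h₁ (t : R) : (⟨t.1.1, t.1.2.2.2.2.1⟩ : Σ a, M.obj a) ∈ S :=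
      Finset.mem_biUnion.2 ⟨t.1, t.2, by simp⟩
    have h₂ (t : R) : (⟨t.1.2.1, t.1.2.2.2.2.2⟩ : Σ a, M.obj a) ∈ S :=
      Finset.mem_biUnion.2 ⟨t.1, t.2, by simp⟩
    have h₃ (t : R) : (⟨t.1.2.1, t.1.2.2.2.1 • act M t.1.2.2.1 t.1.2.2.2.2.1 + t.1.2.2.2.2.2⟩ :
        Σ a, M.obj a) ∈ S :=
      Finset.mem_biUnion.2 ⟨t.1, t.2, by simp⟩
    let r : ∀ (t : R) (i : S), i.1.1 ⟶ t.1.2.1 := fun t =>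
      Pi.single (M := fun i : S => i.1.1 ⟶ t.1.2.1) ⟨_, h₃ t⟩ (𝟙 t.1.2.1) -
        t.1.2.2.2.1 • Pi.single (M := fun i : S => i.1.1 ⟶ t.1.2.1) ⟨_, h₁ t⟩ t.1.2.2.1 -
        Pi.single (M := fun i : S => i.1.1 ⟶ t.1.2.1) ⟨_, h₂ t⟩ (𝟙 t.1.2.1)
    have hcomb {N : A ⥤ ModuleCat.{0} k} (hN : IsMod k N) (n : ∀ i : S, N.obj i.1.1) (t : R) :
        comb hN n _ (r t) = n ⟨_, h₃ t⟩ - t.1.2.2.2.1 • act N t.1.2.2.1 (n ⟨_, h₁ t⟩) -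
          n ⟨_, h₂ t⟩ := by
      simp only [r, map_sub, map_smul]
      rw [comb_single, comb_single, comb_single, act_id, act_id]
    obtain ⟨e, he, her⟩ := exists_lift_of_not_isFP hM.1 hE.1 hg hfp (fun i : S => i.1.2) r
      (fun t => by rw [hcomb]; simp)
    choose s₀ hs₀ using hsurj
    refine ⟨fun a x => if h : (⟨a, x⟩ : Σ a, M.obj a) ∈ S then e ⟨_, h⟩ else s₀ a x,
      fun a x => ?_, fun a b f c x y ht => ?_⟩
    · beta_reduce
      split_ifs with h
      · exact he ⟨_, h⟩
      · exact hs₀ a x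
    · have := her ⟨_, ht⟩
      rw [hcomb, sub_sub, sub_eq_zero] at this
      have e₁ := h₁ ⟨_, ht⟩
      have e₂ := h₂ ⟨_, ht⟩
      have e₃ := h₃ ⟨_, ht⟩
      dsimp only at e₁ e₂ e₃ ⊢
      simp only [e₁, e₂, e₃, dite_true]
      exact this
  choose s hgs' hs using key
  obtain ⟨l, hl1, hl⟩ := exists_limit_functional (k := k) T
  have := hE.2
  have := hM.2
  choose σ hσ using fun a (x : M.obj a) => exists_limit l fun R => s R a x
  have hlin (a b : A) (f : a ⟶ b) (c : k) (x : M.obj a) (y : M.obj b) :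
      σ b (c • act M f x + y) = c • act E f (σ a x) + σ b y := by
    rw [← sub_eq_zero, ← Module.forall_dual_apply_eq_zero_iff k]
    intro φ
    have h1 : φ (act E f (σ a x)) = _ := hσ a x (φ ∘ₗ act E f)
    have h2 : l (fun R => φ (s R b (c • act M f x + y))) =
        l (c • (fun R => φ (act E f (s R a x))) + fun R => φ (s R b y)) :=
      hl ⟨a, b, f, c, x, y⟩ _ _ fun R hR => by simp [hs R a b f c x y hR]
    rw [map_add l, map_smul l] at h2
    rw [map_sub φ, map_add φ, map_smul φ, hσ, hσ, h1, h2]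
    exact sub_self _
  have h0 (a) : σ a 0 = 0 := by
    have := hlin a a (𝟙 a) 1 0 0
    simpa using this
  let u : M ⟶ E := mkHom (fun a => ⟨⟨σ a, fun x y => by simpa using hlin a a (𝟙 a) 1 x y⟩,
    fun c x => by simpa [h0] using hlin a a (𝟙 a) c x 0⟩)
    fun {a b} f x => by simpa [h0] using hlin a b f 1 x 0
  refine hgs (IsSplitEpi.mk' ⟨u, hom_ext_ap fun a x => ?_⟩)
  rw [ap_comp, ap_id]
  change ap g a (σ a x) = x
  rw [← sub_eq_zero, ← Module.forall_dual_apply_eq_zero_iff k]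
  intro φ
  have h1 : φ (ap g a (σ a x)) = _ := hσ a x (φ ∘ₗ ap g a)
  have h2 : (fun _ : Finset T => φ x) = φ x • fun _ => 1 := by ext; simp
  rw [map_sub, h1]
  simp only [LinearMap.comp_apply, hgs']
  rw [h2, map_smul, hl1]
  simp

end Compactness

section Indecomposable

lemma isIso_of_injective_ap (hM : IsLfdMod k M) {p : M ⟶ M}
    (hp : ∀ c, Function.Injective (ap p c)) : IsIso p :=
  isIso_of_bijective_ap fun c =>
    have := hM.2 c
    ⟨hp c, LinearMap.injective_iff_surjective.1 (hp c)⟩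

lemma isIso_left_of_isIso_comp (hM : IsLfdMod k M) {p q : M ⟶ M} [IsIso (p ≫ q)] : IsIso p :=
  have := mono_of_mono p q
  isIso_of_injective_ap hM (mono_iff_ap.1 this)

lemma isIso_right_of_isIso_comp (hM : IsLfdMod k M) {p q : M ⟶ M} [IsIso (p ≫ q)] : IsIso q := by
  have := isIso_left_of_isIso_comp hM (p := p) (q := q)
  exact IsIso.of_isIso_comp_left p q

/-- Fitting's lemma. -/
lemma isIso_or_locally_nilpotent (hM : IsLfdMod k M) (hind : Indec k M) (p : M ⟶ M) :
    IsIso p ∨ ∀ c (x : M.obj c), ∃ n, (ap p c ^ n) x = 0 := by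
  have hC (c) := by
    have := hM.2 c
    exact (ap p c).isCompl_iSup_ker_pow_iInf_range_pow
  have hmem (c) (x : M.obj c) : x ∈ ⨆ n, LinearMap.ker (ap p c ^ n) ↔ ∃ n, (ap p c ^ n) x = 0 :=
    Submodule.mem_iSup_of_directed _ (ap p c).iterateKer.monotone.directed_le
  have hK : ∀ {a b : A} (f : a ⟶ b), ∀ x ∈ ⨆ n, LinearMap.ker (ap p a ^ n),
      act M f x ∈ ⨆ n, LinearMap.ker (ap p b ^ n) := by
    intro a b f x hx
    rw [hmem] at hx ⊢
    obtain ⟨n, hn⟩ := hx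
    exact ⟨n, by rw [← act_ap_pow, hn, map_zero]⟩
  have hI : ∀ {a b : A} (f : a ⟶ b), ∀ x ∈ ⨅ n, LinearMap.range (ap p a ^ n),
      act M f x ∈ ⨅ n, LinearMap.range (ap p b ^ n) := by
    intro a b f x hx
    rw [Submodule.mem_iInf] at hx ⊢
    intro n
    obtain ⟨y, rfl⟩ := hx n
    exact ⟨act M f y, (act_ap_pow p n f y).symm⟩
  let d := biprod.desc (subIncl hK) (subIncl hI)
  have hd (c) (z) : ap d c z = ap (subIncl hK) c (ap biprod.fst c z) +
      ap (subIncl hI) c (ap biprod.snd c z) := by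
    rw [← ap_comp, ← ap_comp, ← ap_add, ← biprod.desc_eq]
  have : IsIso d := by
    refine isIso_of_bijective_ap fun c => ⟨?_, fun x => ?_⟩
    · rw [injective_iff_map_eq_zero]
      intro z hz
      rw [hd] at hz
      have h1 := Submodule.disjoint_def.1 (hC c).disjoint _
        (ap_subIncl_mem hK c (ap biprod.fst c z))
      have h2 : ap (subIncl hK) c (ap biprod.fst c z) = 0 := by
        refine h1 ?_
        rw [eq_neg_of_add_eq_zero_left hz]
        exact neg_mem (ap_subIncl_mem hI c _)
      rw [h2, zero_add] at hz
      have h3 := subIncl_injective hK c (h2.trans (map_zero _).symm)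
      have h4 := subIncl_injective hI c (hz.trans (map_zero _).symm)
      rw [← ap_id c z, ← biprod.total, ap_add, ap_comp, ap_comp, h3, h4, map_zero, map_zero,
        add_zero]
    · have hx : x ∈ (⨆ n, LinearMap.ker (ap p c ^ n)) ⊔ ⨅ n, LinearMap.range (ap p c ^ n) := by
        rw [(hC c).sup_eq_top]
        trivial
      obtain ⟨y, hy, z, hz, rfl⟩ := Submodule.mem_sup.1 hx
      let y' : (subFun M _ hK).obj c := (⟨y, hy⟩ : ↥(⨆ n, LinearMap.ker (ap p c ^ n)))
      let z' : (subFun M _ hI).obj c := (⟨z, hz⟩ : ↥(⨅ n, LinearMap.range (ap p c ^ n)))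
      refine ⟨ap biprod.inl c y' + ap biprod.inr c z', ?_⟩
      rw [map_add, ← ap_comp, ← ap_comp, biprod.inl_desc, biprod.inr_desc]
      rfl
  rcases hind.2 (isLfdMod_of_injective _ (subIncl_injective hK) hM)
    (isLfdMod_of_injective _ (subIncl_injective hI) hM) (asIso d).symm with h | h
  · refine .inl (isIso_of_injective_ap hM fun c => ?_)
    rw [injective_iff_map_eq_zero]
    intro x hx
    let y : (subFun M _ hK).obj c :=
      (⟨x, (hmem c x).2 ⟨1, by simpa using hx⟩⟩ : ↥(⨆ n, LinearMap.ker (ap p c ^ n)))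
    change ap (subIncl hK) c y = 0
    rw [eq_zero_of_isZero h y, map_zero]
  · refine .inr fun c x => ?_
    rw [← hmem]
    have hI0 : ⨅ n, LinearMap.range (ap p c ^ n) = ⊥ := by
      rw [eq_bot_iff]
      intro z hz
      let z' : (subFun M _ hI).obj c := (⟨z, hz⟩ : ↥(⨅ n, LinearMap.range (ap p c ^ n)))
      change ap (subIncl hI) c z' = 0
      rw [eq_zero_of_isZero h z', map_zero]
    have := (hC c).sup_eq_top
    rw [hI0, sup_bot_eq] at this
    rw [this]
    trivial

lemma isIso_or_of_isIso_add (hM : IsLfdMod k M) (hind : Indec k M) (p q : M ⟶ M)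
    [IsIso (p + q)] : IsIso p ∨ IsIso q := by
  rcases isIso_or_locally_nilpotent hM hind (inv (p + q) ≫ p) with h | h
  · exact .inl (isIso_right_of_isIso_comp hM (p := inv (p + q)))
  · right
    have hpq : inv (p + q) ≫ p + inv (p + q) ≫ q = 𝟙 M := by
      rw [← Preadditive.comp_add, IsIso.inv_hom_id]
    have : IsIso (inv (p + q) ≫ q) := by
      refine isIso_of_injective_ap hM fun c => ?_
      rw [injective_iff_map_eq_zero]
      intro x hx
      have h1 : ap (inv (p + q) ≫ p) c x = x := by
        have := congrArg (fun u => ap u c x) hpq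
        simpa only [ap_add, hx, add_zero, ap_id] using this
      obtain ⟨n, hn⟩ := h c x
      have h2 (n : ℕ) : (ap (inv (p + q) ≫ p) c ^ n) x = x := by
        induction n with
        | zero => simp
        | succ n ih => rw [pow_succ, Module.End.mul_apply, h1, ih]
      rw [← hn, h2]
    exact isIso_right_of_isIso_comp hM (p := inv (p + q))

lemma not_isIso_zero (hind : Indec k M) : ¬ IsIso (0 : M ⟶ M) := fun h =>
  hind.1 ((IsZero.iff_id_eq_zero M).2 (by rw [← IsIso.hom_inv_id (0 : M ⟶ M), zero_comp]))

variable {ι : Type} [Fintype ι] {a : ι → A}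

/-- A functional detecting the generators, and vanishing on their images under non-invertible
endomorphisms. -/
lemma exists_radical_functional (hM : IsLfdMod k M) (hind : Indec k M) {m : ∀ i, M.obj (a i)}
    (hm : Generates hM.1 m) : ∃ Φ : (∀ i, M.obj (a i)) →ₗ[k] k, Φ m ≠ 0 ∧
      ∀ p : M ⟶ M, ¬ IsIso p → Φ (fun i => ap p (a i) (m i)) = 0 := by
  let W : Submodule k (∀ i, M.obj (a i)) :=
    { carrier := {y | ∃ p : M ⟶ M, ¬ IsIso p ∧ (fun i => ap p (a i) (m i)) = y}
      zero_mem' := ⟨0, not_isIso_zero hind, by ext; simp⟩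
      add_mem' := by
        rintro _ _ ⟨p, hp, rfl⟩ ⟨q, hq, rfl⟩
        exact ⟨p + q, fun h => (isIso_or_of_isIso_add hM hind p q).elim hp hq, by ext; simp⟩
      smul_mem' := by
        rintro t _ ⟨p, hp, rfl⟩
        refine ⟨p ≫ (t • 𝟙 M), fun h => hp (isIso_left_of_isIso_comp hM (q := t • 𝟙 M)), ?_⟩
        ext
        simp }
  have hW : m ∉ W := by
    rintro ⟨p, hp, h⟩
    refine hp ?_
    rw [hm.hom_ext hM.1 (u := p) (v := 𝟙 M) fun i => by rw [congrFun h i, ap_id]]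
    infer_instance
  obtain ⟨Φ, hΦ, h⟩ := Submodule.exists_le_ker_of_notMem hW
  exact ⟨Φ, hΦ, fun p hp => h ⟨p, hp, rfl⟩⟩

end Indecomposable

section Extension

/-- The first projection of a product of two modules. -/
def prodFst (M N : A ⥤ ModuleCat.{0} k) : prodFun M N ⟶ M :=
  mkHom (fun c => LinearMap.fst k (M.obj c) (N.obj c)) fun _ _ => rfl

/-- The second projection of a product of two modules. -/
def prodSnd (M N : A ⥤ ModuleCat.{0} k) : prodFun M N ⟶ N :=
  mkHom (fun c => LinearMap.snd k (M.obj c) (N.obj c)) fun _ _ => rfl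

/-- The projections of a product of modules. -/
def piProj {κ : Type} (M : κ → A ⥤ ModuleCat.{0} k) (j : κ) : piFun M ⟶ M j :=
  mkHom (fun c => LinearMap.proj (φ := fun j => (M j).obj c) j) fun _ _ => rfl

variable {ι κ : Type} [Fintype κ] {a : ι → A} {b : κ → A}

/-- The extension of `M` whose elements at `c` are pairs of a family of functionals
`θ j : Hom(c, b j) → k` and an element of `M` compatible with a given functional. -/
lemma exists_extension [Spectroid k A] [DecidableEq ι] (hM : IsLfdMod k M) (r : ∀ j i, a i ⟶ b j)
    (Φ : (∀ i, M.obj (a i)) →ₗ[k] k) :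
    ∃ (E : A ⥤ ModuleCat.{0} k) (_ : IsLfdMod k E) (g : E ⟶ M)
      (θ : ∀ c, E.obj c →ₗ[k] ∀ j, Module.Dual k (c ⟶ b j)),
      (∀ {c d : A} (f : c ⟶ d) z j h, θ d (act E f z) j h = θ c z j (f ≫ h)) ∧
      (∀ c z, θ c z = 0 → ap g c z = 0 → z = 0) ∧
      (∀ c z i (h : c ⟶ a i), ∑ j, θ c z j (h ≫ r j i) =
        Φ (Pi.single i (act M h (ap g c z)))) ∧
      ∀ c (t : ∀ j, Module.Dual k (c ⟶ b j)) (x : M.obj c), (∀ i (h : c ⟶ a i),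
        ∑ j, t j (h ≫ r j i) = Φ (Pi.single i (act M h x))) → ∃ z, θ c z = t ∧ ap g c z = x := by
  let I := piFun fun j => InjAt k (b j)
  let θ (c : A) : (prodFun I M).obj c →ₗ[k] ∀ j, Module.Dual k (c ⟶ b j) :=
    LinearMap.pi fun j => (injEquiv (b j) c).symm.toLinearMap ∘ₗ
      ap (prodFst I M ≫ piProj (fun j => InjAt k (b j)) j) c
  have hθ {c d : A} (f : c ⟶ d) (z) (j) (h) : θ d (act _ f z) j h = θ c z j (f ≫ h) := rfl
  let W (c : A) : Submodule k ((prodFun I M).obj c) :=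
    { carrier := {z | ∀ i (h : c ⟶ a i), ∑ j, θ c z j (h ≫ r j i) =
        Φ (Pi.single i (act M h (ap (prodSnd I M) c z)))}
      zero_mem' := fun i h => by simp
      add_mem' := fun {x y} hx hy i h => by
        have e : Φ (Pi.single i (act M h (ap (prodSnd I M) c (x + y)))) =
            Φ (Pi.single i (act M h (ap (prodSnd I M) c x))) +
              Φ (Pi.single i (act M h (ap (prodSnd I M) c y))) := by
          rw [← map_add Φ, ← Pi.single_add, map_add (ap _ _), map_add (act M h)]
        rw [e, ← hx, ← hy, map_add (θ c), ← Finset.sum_add_distrib]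
        rfl
      smul_mem' := fun t x hx i h => by
        have e : Φ (Pi.single i (act M h (ap (prodSnd I M) c (t • x)))) =
            t • Φ (Pi.single i (act M h (ap (prodSnd I M) c x))) := by
          rw [← map_smul Φ, ← Pi.single_smul, map_smul (ap _ _), map_smul (act M h)]
        rw [e, ← hx, map_smul (θ c), Finset.smul_sum]
        rfl }
  have hW : ∀ {c d : A} (f : c ⟶ d), ∀ z ∈ W c, act _ f z ∈ W d := by
    intro c d f z hz i h
    rw [ap_act, ← act_comp, ← hz]
    simp only [hθ, Category.assoc]
  refine ⟨subFun _ W hW, isLfdMod_of_injective _ (subIncl_injective hW)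
    (isLfdMod_prodFun (isLfdMod_piFun fun j => isLfdMod_injAt (b j)) hM), subIncl hW ≫ prodSnd I M,
    fun c => θ c ∘ₗ ap (subIncl hW) c, fun f z j h => rfl, fun c z h1 h2 => ?_,
    fun c z i h => ap_subIncl_mem hW c z i h, fun c t x h => ?_⟩
  · exact Subtype.ext (Prod.ext h1 h2)
  · let z : (prodFun I M).obj c := (t, x)
    have hz : z ∈ W c := h
    exact ⟨(⟨z, hz⟩ : W c), rfl, rfl⟩

/-- The properties of the extension of `M` used to find an almost split sequence: it is right
almost split and its kernel is cogenerated at the objects `b j`. -/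
structure IsCogenSplit {E : A ⥤ ModuleCat.{0} k} (b : κ → A) (g : E ⟶ M) : Prop where
  lfd : IsLfdMod k E
  epi : Epi g
  not_splitEpi : ¬ IsSplitEpi g
  lift : ∀ ⦃X : A ⥤ ModuleCat.{0} k⦄, IsLfdMod k X → ∀ u : X ⟶ M, ¬ IsSplitEpi u →
    ∃ v : X ⟶ E, v ≫ g = u
  cogen : ∀ c z, ap g c z = 0 → (∀ j (h : c ⟶ b j), act E h z = 0) → z = 0

lemma exists_factor_of_ker_le {V U : Type} [AddCommGroup V] [Module k V] [AddCommGroup U]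
    [Module k U] (R : V →ₗ[k] U) (ψ : V →ₗ[k] k) (h : ∀ v, R v = 0 → ψ v = 0) :
    ∃ Θ : U →ₗ[k] k, ∀ v, Θ (R v) = ψ v := by
  have : ψ ∈ (LinearMap.ker R).dualAnnihilator := by
    rw [Submodule.mem_dualAnnihilator]
    exact h
  rw [← LinearMap.range_dualMap_eq_dualAnnihilator_ker] at this
  obtain ⟨Θ, rfl⟩ := this
  exact ⟨Θ, fun _ => rfl⟩

/-- The morphism `P_c → M` given by an element of `M`. -/
lemma exists_yoneda (hM : IsMod k M) (c : A) (x : M.obj c) :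
    ∃ u : ProjAt k c ⟶ M, ap u c (projEquiv c c (𝟙 c)) = x := by
  let φ (d : A) : (c ⟶ d) →ₗ[k] M.obj d :=
    { toFun := fun h => act M h x
      map_add' := fun f g => act_add hM f g x
      map_smul' := fun t f => act_smul hM t f x }
  refine ⟨mkHom (fun d => φ d ∘ₗ (projEquiv c d).symm.toLinearMap) fun {d e} f h => ?_, ?_⟩
  · obtain ⟨h, rfl⟩ := (projEquiv c d).surjective h
    rw [act_projEquiv]
    simp [φ]
  · simp [φ]

lemma projInMod_of_isSplitEpi {c : A} (u : ProjAt k c ⟶ M) [IsSplitEpi u] : ProjInMod k M := by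
  intro X Y hX _ e he w
  obtain ⟨x, hx⟩ := epi_iff_ap.1 he c (ap (u ≫ w) c (projEquiv c c (𝟙 c)))
  obtain ⟨t, ht⟩ := exists_yoneda hX.1 c x
  have h : t ≫ e = u ≫ w := hom_ext_ap fun d h => by
    obtain ⟨h, rfl⟩ := (projEquiv c d).surjective h
    have h1 := act_projEquiv (k := k) c h (𝟙 c)
    rw [Category.id_comp] at h1
    rw [← h1, ap_act, ap_act, ap_comp, ht, hx]
  exact ⟨section_ u ≫ t, by rw [Category.assoc, h, IsSplitEpi.id_assoc]⟩

lemma exists_isCogenSplit [Spectroid k A] [Fintype ι] (hM : IsLfdMod k M) (hind : Indec k M)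
    (hnp : ¬ ProjInMod k M) {m : ∀ i, M.obj (a i)} {r : ∀ j i, a i ⟶ b j}
    (h : IsPres hM.1 m r) : ∃ (E : A ⥤ ModuleCat.{0} k) (g : E ⟶ M), IsCogenSplit b g := by
  classical
  obtain ⟨Φ, hΦ, hΦ0⟩ := exists_radical_functional hM hind h.gen
  obtain ⟨E, hE, g, θ, hnat, hinj, hcomp, hex⟩ := exists_extension hM r Φ
  have hsum (y : ∀ i, M.obj (a i)) : Φ y = ∑ i, Φ (Pi.single i (y i)) := by
    rw [← map_sum, Finset.univ_sum_single]
  have hlift : ∀ ⦃X : A ⥤ ModuleCat.{0} k⦄, IsLfdMod k X → ∀ u : X ⟶ M, ¬ IsSplitEpi u →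
      ∃ v : X ⟶ E, v ≫ g = u := by
    intro X hX u hu
    let R : (∀ i, X.obj (a i)) →ₗ[k] ∀ j, X.obj (b j) :=
      LinearMap.pi fun j => ∑ i, act X (r j i) ∘ₗ LinearMap.proj i
    have hR (y) (j) : R y j = comb hX.1 y (b j) (r j) := by
      simp [R, comb_apply]
    obtain ⟨Θ, hΘ⟩ := exists_factor_of_ker_le R
      (Φ ∘ₗ LinearMap.pi fun i => ap u (a i) ∘ₗ LinearMap.proj i) fun y hy => by
        obtain ⟨v, hv⟩ := h.exists_desc hX.1 y fun j => by rw [← hR, hy]; rfl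
        have h1 := hΦ0 (v ≫ u) fun hi =>
          hu (IsSplitEpi.mk' ⟨inv (v ≫ u) ≫ v, by rw [Category.assoc, IsIso.inv_hom_id]⟩)
        simp only [ap_comp, hv] at h1
        exact h1
    let t (c) (x : X.obj c) (j) : Module.Dual k (c ⟶ b j) :=
      { toFun := fun f => Θ (Pi.single j (act X f x))
        map_add' := fun f f' => by rw [act_add hX.1, Pi.single_add, map_add]
        map_smul' := fun s f => by rw [act_smul hX.1, Pi.single_smul, map_smul]; rfl }
    have ht (c) (x : X.obj c) : ∃ z, θ c z = t c x ∧ ap g c z = ap u c x := by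
      refine hex c _ _ fun i f => ?_
      have h1 : ∑ j, t c x j (f ≫ r j i) = Θ (R (Pi.single i (act X f x))) := by
        change ∑ j, Θ (Pi.single j (act X (f ≫ r j i) x)) = _
        rw [← map_sum, Finset.univ_sum_single fun j => act X (f ≫ r j i) x]
        congr 1
        ext j
        rw [hR, comb_apply, Finset.sum_eq_single i]
        · simp
        · intro i' _ hi
          rw [Pi.single_eq_of_ne hi, map_zero]
        · simp
      rw [h1, hΘ, ← ap_act]
      change Φ _ = _
      congr 1
      ext i'
      exact Pi.apply_single (fun i => ap u (a i)) (fun i => map_zero _) i (act X f x) i'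
    choose φ hφ hφ' using ht
    have hext (c) (z z' : E.obj c) (h1 : θ c z = θ c z') (h2 : ap g c z = ap g c z') : z = z' := by
      rw [← sub_eq_zero] at *
      exact hinj c _ (by rw [map_sub, h1]) (by rw [map_sub, h2])
    refine ⟨mkHom (fun c => ⟨⟨φ c, fun x y => hext c _ _ ?_ ?_⟩, fun s x => hext c _ _ ?_ ?_⟩)
      fun f x => hext _ _ _ ?_ ?_, hom_ext_ap fun c x => ?_⟩
    · rw [map_add, hφ, hφ, hφ]
      ext j f
      simp [t, Pi.single_add]
    · simp [hφ']
    · change θ c (φ c (s • x)) = θ c (s • φ c x)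
      rw [map_smul, hφ, hφ]
      ext j f
      simp [t, Pi.single_smul]
    · simp [hφ']
    · change θ _ (φ _ (act X f x)) = θ _ (act E f (φ _ x))
      ext j l
      rw [hnat, hφ, hφ]
      simp [t]
    · simp [hφ', ap_act]
    · simp [hφ']
  refine ⟨E, g, hE, epi_iff_ap.2 fun c x => ?_, fun hs => hΦ ?_, hlift, fun c z hz h0 => ?_⟩
  · obtain ⟨u, rfl⟩ := exists_yoneda hM.1 c x
    obtain ⟨v, rfl⟩ := hlift (isLfdMod_projAt c) u fun hu => hnp (projInMod_of_isSplitEpi u)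
    exact ⟨_, (ap_comp v g c _).symm⟩
  · have hs' (c) (x : M.obj c) : ap g c (ap (section_ g) c x) = x := by
      rw [← ap_comp, IsSplitEpi.id, ap_id]
    have h1 (i) : Φ (Pi.single i (m i)) = ∑ j, θ (b j) (ap (section_ g) (b j)
        (act M (r j i) (m i))) j (𝟙 (b j)) := by
      have := hcomp (a i) (ap (section_ g) (a i) (m i)) i (𝟙 (a i))
      rw [act_id, hs'] at this
      rw [← this]
      refine Finset.sum_congr rfl fun j _ => ?_
      rw [ap_act, hnat, Category.comp_id, Category.id_comp]
    have h2 (j) : ∑ i, θ (b j) (ap (section_ g) (b j) (act M (r j i) (m i))) j (𝟙 (b j)) = 0 := by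
      have := congrArg (fun x => θ (b j) (ap (section_ g) (b j) x) j (𝟙 (b j))) (h.rel j)
      simpa [comb_apply] using this
    rw [hsum, Finset.sum_congr rfl fun i _ => h1 i, Finset.sum_comm,
      Finset.sum_eq_zero fun j _ => h2 j]
  · refine hinj c z ?_ hz
    ext j f
    rw [← Category.comp_id f, ← hnat, h0]
    simp

end Extension

section Minimal

variable {κ : Type} [Fintype κ] {b : κ → A} {E : A ⥤ ModuleCat.{0} k} {g : E ⟶ M}

lemma IsCogenSplit.isIso_of_minimal (h : IsCogenSplit b g)
    (hmin : ∀ (E' : A ⥤ ModuleCat.{0} k) (g' : E' ⟶ M), IsCogenSplit b g' →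
      ∑ j, Module.finrank k (E.obj (b j)) ≤ ∑ j, Module.finrank k (E'.obj (b j)))
    {q : E ⟶ E} (hq : q ≫ g = g) : IsIso q := by
  have hW : ∀ {c d : A} (f : c ⟶ d), ∀ x ∈ LinearMap.range (ap q c),
      act E f x ∈ LinearMap.range (ap q d) := by
    rintro c d f _ ⟨x, rfl⟩
    exact ⟨act E f x, ap_act q f x⟩
  let q' := subLift hW q fun c x => ⟨x, rfl⟩
  have hq' : q' ≫ subIncl hW ≫ g = g := hq
  have hS : IsCogenSplit b (subIncl hW ≫ g) :=
    { lfd := isLfdMod_of_injective _ (subIncl_injective hW) h.lfd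
      epi := have := h.epi; epi_of_epi_fac hq'
      not_splitEpi := fun _ => h.not_splitEpi (IsSplitEpi.mk'
        ⟨section_ (subIncl hW ≫ g) ≫ subIncl hW, by rw [Category.assoc, IsSplitEpi.id]⟩)
      lift := fun X hX u hu => by
        obtain ⟨v, rfl⟩ := h.lift hX u hu
        exact ⟨v ≫ q', by rw [Category.assoc, hq']⟩
      cogen := fun c z hz h0 => subIncl_injective hW c <| by
        rw [map_zero]
        refine h.cogen c _ (by rwa [← ap_comp]) fun j f => ?_
        rw [← ap_act, h0, map_zero] }
  have hle (j) : Module.finrank k ((subFun E _ hW).obj (b j)) ≤ Module.finrank k (E.obj (b j)) :=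
    have := h.lfd.2 (b j)
    LinearMap.finrank_le_finrank_of_injective (subIncl_injective hW (b j))
  have heq := (Finset.sum_eq_sum_iff_of_le fun j _ => hle j).1
    (le_antisymm (Finset.sum_le_sum fun j _ => hle j) (hmin _ _ hS))
  have hinj (j) : Function.Injective (ap q (b j)) := by
    have := h.lfd.2 (b j)
    rw [LinearMap.injective_iff_surjective, ← LinearMap.range_eq_top]
    exact Submodule.eq_top_of_finrank_eq (heq j (Finset.mem_univ j))
  refine isIso_of_injective_ap h.lfd fun c => ?_
  rw [injective_iff_map_eq_zero]
  intro x hx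
  refine h.cogen c x (by rw [← hq, ap_comp, hx, map_zero]) fun j f => hinj j ?_
  rw [ap_act, hx, map_zero, map_zero]

lemma IsCogenSplit.exists_minimal (h : IsCogenSplit b g) :
    ∃ (E : A ⥤ ModuleCat.{0} k) (g : E ⟶ M), IsCogenSplit b g ∧
      ∀ q : E ⟶ E, q ≫ g = g → IsIso q := by
  let S : Set ℕ := {n | ∃ (E : A ⥤ ModuleCat.{0} k) (g : E ⟶ M), IsCogenSplit b g ∧
    ∑ j, Module.finrank k (E.obj (b j)) = n}
  obtain ⟨E, g, hg, hn⟩ : sInf S ∈ S := Nat.sInf_mem ⟨_, E, g, h, rfl⟩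
  refine ⟨E, g, hg, fun q hq => hg.isIso_of_minimal (fun E' g' hg' => ?_) hq⟩
  rw [hn]
  exact Nat.sInf_le ⟨E', g', hg', rfl⟩

end Minimal

section Pushout

variable {L E : A ⥤ ModuleCat.{0} k}

lemma isLfdMod_pushout (hE : IsLfdMod k E) (hX : IsLfdMod k X) (f : L ⟶ E) (u : L ⟶ X) :
    IsLfdMod k (pushout f u) :=
  isLfdMod_of_surjective (M := prodFun E X)
    (prodFst E X ≫ pushout.inl f u + prodSnd E X ≫ pushout.inr f u) (fun c y => by
      obtain ⟨e, x, rfl⟩ := exists_pushout_eq f u y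
      exact ⟨(e, x), rfl⟩) (isLfdMod_prodFun hE hX)

/-- A right minimal right almost split epimorphism gives an almost split sequence. -/
lemma almostSplitSeq_of_rightMinimal {g : E ⟶ M} (hE : IsLfdMod k E) [Epi g]
    (hgs : ¬ IsSplitEpi g)
    (hg : ∀ ⦃X : A ⥤ ModuleCat.{0} k⦄, IsLfdMod k X → ∀ u : X ⟶ M, ¬ IsSplitEpi u →
      ∃ v : X ⟶ E, v ≫ g = u)
    (hmin : ∀ q : E ⟶ E, q ≫ g = g → IsIso q) : AlmostSplitSeq k (kernel.ι g) g where
  mono := inferInstance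
  epi := inferInstance
  zero := kernel.condition g
  exact := ShortComplex.exact_kernel g
  not_splitEpi := hgs
  right_almost_split := hg
  not_splitMono := fun _ => by
    have hq := hmin (𝟙 E - retraction (kernel.ι g) ≫ kernel.ι g) (by simp)
    have h0 : kernel.ι g ≫ (𝟙 E - retraction (kernel.ι g) ≫ kernel.ι g) = 0 := by simp
    have : Mono g := Preadditive.mono_of_kernel_zero (zero_of_comp_mono _ h0)
    have := isIso_of_mono_of_epi g
    exact hgs inferInstance
  left_almost_split := by
    intro X hX u hu
    let π : pushout (kernel.ι g) u ⟶ M := pushout.desc g 0 (by simp)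
    have hl : pushout.inl (kernel.ι g) u ≫ π = g := pushout.inl_desc _ _ _
    have hr : pushout.inr (kernel.ι g) u ≫ π = 0 := pushout.inr_desc _ _ _
    by_cases hs : IsSplitEpi π
    · obtain ⟨w, hw⟩ := exists_lift_of_injective (i := pushout.inr (kernel.ι g) u)
        (mono_iff_ap.1 inferInstance) (𝟙 _ - π ≫ section_ π) fun c y => by
          have h0 : ap π c (ap (𝟙 _ - π ≫ section_ π) c y) = 0 := by
            rw [← ap_comp]
            simp
          obtain ⟨e, x, h⟩ := exists_pushout_eq (kernel.ι g) u (ap (𝟙 _ - π ≫ section_ π) c y)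
          rw [← h, map_add, ← ap_comp, ← ap_comp, hl, hr, ap_zero, add_zero] at h0
          obtain ⟨l, rfl⟩ := exists_ap_kernel_ι_eq g h0
          refine ⟨ap u c l + x, ?_⟩
          rw [← h, map_add, ← ap_comp, ← ap_comp, pushout.condition]
      refine ⟨pushout.inl (kernel.ι g) u ≫ w, ?_⟩
      rw [← cancel_mono (pushout.inr (kernel.ι g) u), Category.assoc, Category.assoc, hw,
        ← Category.assoc, pushout.condition, Category.assoc, Preadditive.comp_sub,
        Category.comp_id, reassoc_of% hr, zero_comp, sub_zero]
    · exfalso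
      obtain ⟨t, ht⟩ := hg (isLfdMod_pushout hE hX _ _) π hs
      let p := pushout.inl (kernel.ι g) u ≫ t
      have hp : p ≫ g = g := by rw [Category.assoc, ht, hl]
      have := hmin p hp
      let w := kernel.lift g (pushout.inr (kernel.ι g) u ≫ t) (by rw [Category.assoc, ht, hr])
      let p' := kernel.lift g (kernel.ι g ≫ inv p) (by
        rw [Category.assoc, (IsIso.inv_comp_eq p).2 hp.symm, kernel.condition])
      refine hu (IsSplitMono.mk' ⟨w ≫ p', ?_⟩)
      rw [← cancel_mono (kernel.ι g), Category.id_comp, Category.assoc, Category.assoc,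
        kernel.lift_ι, kernel.lift_ι_assoc, Category.assoc, ← pushout.condition_assoc,
        ← Category.assoc (pushout.inl _ _)]
      change kernel.ι g ≫ p ≫ inv p = _
      rw [IsIso.hom_inv_id, Category.comp_id]

end Pushout

lemma exists_almostSplitSeq_of_isFP [Spectroid k A] (hM : IsLfdMod k M) (hind : Indec k M)
    (hnp : ¬ ProjInMod k M) (hfp : IsFP k M) :
    ∃ (L E : A ⥤ ModuleCat.{0} k) (_ : IsLfdMod k L) (_ : IsLfdMod k E) (f : L ⟶ E) (g : E ⟶ M),
      AlmostSplitSeq k f g := by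
  obtain ⟨n, p, a, b, m, r, h⟩ := exists_isPres_of_isFP hM.1 hfp
  obtain ⟨_, _, h⟩ := exists_isCogenSplit hM hind hnp h
  obtain ⟨E, g, h, hmin⟩ := h.exists_minimal
  have := h.epi
  exact ⟨_, E, isLfdMod_of_injective _ (ap_kernel_ι_injective g) h.lfd, h.lfd, _, g,
    almostSplitSeq_of_rightMinimal h.lfd h.not_splitEpi h.lift hmin⟩

end Modules

end AlmostSplit

variable (k : Type) [Field k] [IsAlgClosed k]
variable (A : Type) [Category.{0} A] [Preadditive A] [CategoryTheory.Linear k A]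

/-- For an indecomposable non-projective `M` in `mod A`, there is an almost split
sequence ending in `M` if and only if `M` is finitely presented. -/
theorem statement_11 [Spectroid k A] (M : A ⥤ ModuleCat.{0} k)
    (hM : IsLfdMod k M) (hind : Indec k M) (hnp : ¬ ProjInMod k M) :
    (∃ (L E : A ⥤ ModuleCat.{0} k) (_ : IsLfdMod k L) (_ : IsLfdMod k E)
        (f : L ⟶ E) (g : E ⟶ M), AlmostSplitSeq k f g) ↔ IsFP k M := by
  refine ⟨?_, exists_almostSplitSeq_of_isFP hM hind hnp⟩
  rintro ⟨L, E, _, hE, f, g, h⟩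
  have := h.epi
  exact isFP_of_rightAlmostSplit hM hE h.not_splitEpi h.right_almost_split

end Paper
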